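/- Every (B+1)-partition of G has value at most v*. -/

import Mathlib

open scoped Classical

set_option linter.unnecessarySeqFocus false

/-- Vertices of the bin-packing graph: clique vertices `(j, a)` together with
the `k` bin vertices `b_i`. -/
abbrev BPV (n k : ℕ) (s : Fin n → ℕ) := (Σ j : Fin n, Fin (s j)) ⊕ Fin k

/-- Adjacency: two clique vertices are adjacent iff they share the first
coordinate; every bin vertex is adjacent to every clique vertex; bin vertices
are pairwise non-adjacent. -/
def bpAdj (n k : ℕ) (s : Fin n → ℕ) : BPV n k s → BPV n k s → Prop
  | Sum.inl x, Sum.inl y => x.1 = y.1 ∧ x ≠ y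
  | Sum.inl _, Sum.inr _ => True
  | Sum.inr _, Sum.inl _ => True
  | Sum.inr _, Sum.inr _ => False

/-- The bin-packing graph `G`. -/
def bpGraph (n k : ℕ) (s : Fin n → ℕ) : SimpleGraph (BPV n k s) where
  Adj := bpAdj n k s
  symm := by
    constructor
    intro a b h
    cases a <;> cases b <;> simp only [bpAdj] at h ⊢ <;> try trivial
    exact ⟨h.1.symm, fun e => h.2 e.symm⟩
  loopless := by
    constructor
    intro a h
    cases a <;> simp_all [bpAdj]

/-- The number of edges of `G` with both endpoints in `Q`. -/
noncomputable def partVal {V : Type*} [DecidableEq V] (G : SimpleGraph V)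
    (Q : Finset V) : ℕ :=
  (Q.sym2.filter (fun e => e ∈ G.edgeSet)).card

/-- The (unweighted) value of a partition `P`: the number of edges of `G` with
both endpoints in a common part of `P`. -/
noncomputable def pVal {V : Type*} [Fintype V] [DecidableEq V] (G : SimpleGraph V)
    (P : Finpartition (Finset.univ : Finset V)) : ℕ :=
  ∑ Q ∈ P.parts, partVal G Q

/-- Summing the sizes of the bin-vertex sets of the parts of a partition counts each bin vertex
once. -/
lemma sum_card_filter_isRight {α β : Type*} [Fintype α] [Fintype β]
    [DecidableEq (α ⊕ β)] (P : Finpartition (Finset.univ : Finset (α ⊕ β))) :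
    ∑ Q ∈ P.parts, (Q.filter (fun v => v.isRight = true)).card = Fintype.card β := by
  have h := Finset.sum_biUnion (s := P.parts) (t := id)
    (f := fun v : α ⊕ β => if v.isRight = true then 1 else 0) P.disjoint
  rw [P.biUnion_parts] at h
  simp only [Finset.card_filter]
  rw [show ∑ Q ∈ P.parts, ∑ v ∈ Q, (if v.isRight = true then 1 else 0) = _ from h.symm]
  rw [Fintype.sum_sum_type]
  simp

/-- The edges between two clique vertices that lie inside `Q`. -/
noncomputable def cliqueEdges (n k : ℕ) (s : Fin n → ℕ) (Q : Finset (BPV n k s)) :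
    Finset (Sym2 (BPV n k s)) :=
  Q.sym2.filter (fun e => e ∈ (bpGraph n k s).edgeSet ∧ ∀ v ∈ e, v.isLeft = true)

lemma card_cliqueEdges_univ_le (n k : ℕ) (s : Fin n → ℕ) :
    (cliqueEdges n k s Finset.univ).card ≤ ∑ j : Fin n, s j * (s j - 1) / 2 := by
  let T : Finset (Σ j : Fin n, Sym2 (Fin (s j))) :=
    Finset.univ.sigma (fun _ => Finset.univ.filter (fun e => ¬ e.IsDiag))
  let f : (Σ j : Fin n, Sym2 (Fin (s j))) → Sym2 (BPV n k s) :=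
    fun p => p.2.map (fun a => Sum.inl ⟨p.1, a⟩)
  have hsub : cliqueEdges n k s Finset.univ ⊆ T.image f := by
    intro e
    induction e using Sym2.ind with
    | _ x y =>
      intro h
      simp only [cliqueEdges, Finset.mem_filter, SimpleGraph.mem_edgeSet, Sym2.mem_iff] at h
      obtain ⟨-, hadj, hl⟩ := h
      have hx := hl x (Or.inl rfl)
      have hy := hl y (Or.inr rfl)
      rcases x with ⟨j, a⟩ | x
      · rcases y with ⟨j', b⟩ | y
        · obtain ⟨h1, h2⟩ := hadj
          obtain rfl : j = j' := h1
          refine Finset.mem_image.2 ⟨⟨j, s(a, b)⟩, ?_, rfl⟩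
          simp only [T, Finset.mem_sigma, Finset.mem_univ, true_and, Finset.mem_filter,
            Sym2.mk_isDiag_iff]
          rintro rfl
          exact h2 rfl
        · simp at hy
      · simp at hx
  refine (Finset.card_le_card hsub).trans (Finset.card_image_le.trans ?_)
  rw [Finset.card_sigma]
  refine Finset.sum_le_sum fun j _ => ?_
  rw [← Fintype.card_subtype, Sym2.card_subtype_not_diag, Fintype.card_fin, Nat.choose_two_right]

lemma sum_card_cliqueEdges_le (n k : ℕ) (s : Fin n → ℕ)
    (P : Finpartition (Finset.univ : Finset (BPV n k s))) :
    ∑ Q ∈ P.parts, (cliqueEdges n k s Q).card ≤ (cliqueEdges n k s Finset.univ).card := by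
  rw [← Finset.card_biUnion]
  · refine Finset.card_le_card (Finset.biUnion_subset.2 fun Q _ => ?_)
    exact Finset.filter_subset_filter _ (Finset.sym2_mono (Finset.subset_univ Q))
  · intro Q hQ R hR hne
    refine Finset.disjoint_left.2 fun e he he' => ?_
    have h1 := Finset.mem_sym2_iff.1 (Finset.mem_filter.1 he).1 _ e.out_fst_mem
    have h2 := Finset.mem_sym2_iff.1 (Finset.mem_filter.1 he').1 _ e.out_fst_mem
    exact Finset.disjoint_left.1 (P.disjoint hQ hR hne) h1 h2

/-- A part with at most `B + 1` vertices has at most `B` edges per bin vertex, besides its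
clique edges. -/
lemma partVal_le (n k B : ℕ) (s : Fin n → ℕ) (Q : Finset (BPV n k s)) (hQ : Q.card ≤ B + 1) :
    partVal (bpGraph n k s) Q ≤
      (cliqueEdges n k s Q).card + (Q.filter (fun v => v.isRight = true)).card * B := by
  set R := Q.filter (fun v => v.isRight = true) with hR
  set L := Q.filter (fun v => ¬ v.isRight = true) with hL
  have hsub : Q.sym2.filter (fun e => e ∈ (bpGraph n k s).edgeSet) ⊆
      cliqueEdges n k s Q ∪ (R ×ˢ L).image (fun p => s(p.1, p.2)) := by
    intro e
    induction e using Sym2.ind with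
    | _ x y =>
      intro h
      obtain ⟨hm, hadj⟩ := Finset.mem_filter.1 h
      obtain ⟨hx, hy⟩ := Finset.mk_mem_sym2_iff.1 hm
      rw [Finset.mem_union]
      rcases x with x | x <;> rcases y with y | y
      · left
        refine Finset.mem_filter.2 ⟨hm, hadj, fun v hv => ?_⟩
        rcases Sym2.mem_iff.1 hv with rfl | rfl <;> rfl
      · right
        exact Finset.mem_image.2 ⟨(Sum.inr y, Sum.inl x), by simp [hR, hL, hx, hy], Sym2.eq_swap⟩
      · right
        exact Finset.mem_image.2 ⟨(Sum.inr x, Sum.inl y), by simp [hR, hL, hx, hy], rfl⟩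
      · exact hadj.elim
  have hcard : R.card + L.card = Q.card := Finset.card_filter_add_card_filter_not _
  have hmul : R.card * L.card ≤ R.card * B := by
    rcases Nat.eq_zero_or_pos R.card with h0 | h0
    · simp [h0]
    · exact Nat.mul_le_mul_left _ (by omega)
  calc partVal (bpGraph n k s) Q
      ≤ (cliqueEdges n k s Q ∪ (R ×ˢ L).image (fun p => s(p.1, p.2))).card :=
        Finset.card_le_card hsub
    _ ≤ (cliqueEdges n k s Q).card + ((R ×ˢ L).image (fun p => s(p.1, p.2))).card :=
        Finset.card_union_le _ _
    _ ≤ (cliqueEdges n k s Q).card + R.card * L.card :=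
        Nat.add_le_add_left (Finset.card_image_le.trans (Finset.card_product _ _).le) _
    _ ≤ _ := Nat.add_le_add_left hmul _

/-- Every `(B+1)`-partition of the bin-packing graph has value at most
`v* = Σ_j s j (s j − 1)/2 + k·B`. -/
theorem stmt9 (n k B : ℕ) (hn : 1 ≤ n) (hk : 1 ≤ k) (hB : 1 ≤ B)
    (s : Fin n → ℕ) (hs : ∀ j, 1 ≤ s j)
    (P : Finpartition (Finset.univ : Finset (BPV n k s)))
    (hP : ∀ Q ∈ P.parts, Q.card ≤ B + 1) :
    pVal (bpGraph n k s) P ≤ (∑ j : Fin n, s j * (s j - 1) / 2) + k * B := by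
  calc pVal (bpGraph n k s) P
      ≤ ∑ Q ∈ P.parts, ((cliqueEdges n k s Q).card +
          (Q.filter (fun v => v.isRight = true)).card * B) :=
        Finset.sum_le_sum fun Q hQ => partVal_le n k B s Q (hP Q hQ)
    _ = ∑ Q ∈ P.parts, (cliqueEdges n k s Q).card + k * B := by
        rw [Finset.sum_add_distrib, ← Finset.sum_mul, sum_card_filter_isRight, Fintype.card_fin]
    _ ≤ _ := Nat.add_le_add_right
        ((sum_card_cliqueEdges_le n k s P).trans (card_cliqueEdges_univ_le n k s)) _
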